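/- Let T be a tile system in an arbitrary linear neighborhood N, with finite set of glues X. There exist a finite glue set X_μ, a tile system T_μ in neighborhood N_vN over X_μ, a scale s ≥ 1, a polyomino assignment φ, and a tiling-simulation ψ of T by T_μ such that for every (T,N)-tiling τ: τ is line convex if and only if every poly-tiling in ψ(τ), viewed as a (T_μ,N_vN)-tiling via its induced tiling, is line convex. -/

import Mathlib

namespace Paper

open scoped Classical

abbrev Pos : Type := ℤ × ℤ

/-- The von Neumann neighborhood. -/
def Nvn : Set Pos := {(0, 1), (1, 0), (0, -1), (-1, 0)}

/-- A neighborhood: a finite symmetric set of positions not containing the origin. -/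
def IsNeighborhood (N : Set Pos) : Prop :=
  N.Finite ∧ (0, 0) ∉ N ∧ ∀ w ∈ N, -w ∈ N

/-- A tile over glues `X` and neighborhood `N` : a function from `N` to `X`. -/
abbrev Tile (X : Type) (N : Set Pos) : Type := {w : Pos // w ∈ N} → X

/-- Scaling a position by an integer. -/
def sc (s : ℤ) (u : Pos) : Pos := (s * u.1, s * u.2)

/-- Domain of a partial map on the plane. -/
def tdom {α : Type} (τ : Pos → Option α) : Set Pos := {p | τ p ≠ none}

/-- A (T,N)-tiling: a partial map to tiles of `T` such that all neighboring glues match. -/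
def IsTiling {X : Type} {N : Set Pos} (T : Set (Tile X N))
    (τ : Pos → Option (Tile X N)) : Prop :=
  (∀ p t, τ p = some t → t ∈ T) ∧
  (∀ p t, τ p = some t → ∀ w t', τ (p + w) = some t' →
    ∀ (hw : w ∈ N) (hw' : -w ∈ N), t ⟨w, hw⟩ = t' ⟨-w, hw'⟩)

def IsFiniteTiling {X : Type} {N : Set Pos} (T : Set (Tile X N))
    (τ : Pos → Option (Tile X N)) : Prop :=
  IsTiling T τ ∧ (tdom τ).Finite

/-- A partial map on the plane is total if it is defined everywhere. -/
def TotalDom {α : Type} (τ : Pos → Option α) : Prop := ∀ p, τ p ≠ none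

/-- A poly-tiling of scale `s`: a partial map from grid positions to finite tilings,
satisfying (i) each component is a finite tiling, (ii) translated domains are disjoint,
(iii) neighboring (after translation) tiles of two components have matching glues. -/
def IsPolyTiling {X : Type} {N : Set Pos} (T : Set (Tile X N)) (s : ℤ)
    (σ : Pos → Option (Pos → Option (Tile X N))) : Prop :=
  (∀ u τu, σ u = some τu → IsFiniteTiling T τu) ∧
  (∀ u v τu τv, u ≠ v → σ u = some τu → σ v = some τv →
    ∀ p, τu p ≠ none → ∀ q, τv q ≠ none → sc s u + p ≠ sc s v + q) ∧
  (∀ u u' τu τu', σ u = some τu → σ u' = some τu' →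
    ∀ v t, τu v = some t → ∀ v' t', τu' v' = some t' →
    ∀ (hw : (sc s u' + v') - (sc s u + v) ∈ N)
      (hw' : -((sc s u' + v') - (sc s u + v)) ∈ N),
      t ⟨(sc s u' + v') - (sc s u + v), hw⟩ =
        t' ⟨-((sc s u' + v') - (sc s u + v)), hw'⟩)

/-- The tiling induced by a poly-tiling: position `s•u + v` carries the tile `σ u v`. -/
noncomputable def induced {α : Type} (s : ℤ) (σ : Pos → Option (Pos → Option α)) :
    Pos → Option α := fun p =>
  if h : ∃ t, ∃ u τu v, σ u = some τu ∧ τu v = some t ∧ p = sc s u + v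
    then some h.choose else none

/-- Periodicity of a (partial) tiling, with horizontal and vertical periods. -/
def PeriodicT {α : Type} (τ : Pos → Option α) : Prop :=
  ∃ ph pv : ℤ, 0 < ph ∧ 0 < pv ∧
    ∀ (p : Pos) (a b : ℤ), τ p ≠ none →
      τ (p.1 + a * ph, p.2 + b * pv) ≠ none →
      τ p = τ (p.1 + a * ph, p.2 + b * pv)

def LineConvex {α : Type} (τ : Pos → Option α) : Prop :=
  ∀ x₁ x₂ x y : ℤ, τ (x₁, y) ≠ none → τ (x₂, y) ≠ none →
    x₁ < x → x < x₂ → τ (x, y) ≠ none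

def ColumnConvex {α : Type} (τ : Pos → Option α) : Prop :=
  ∀ x y₁ y₂ y : ℤ, τ (x, y₁) ≠ none → τ (x, y₂) ≠ none →
    y₁ < y → y < y₂ → τ (x, y) ≠ none

/-- 4-connectedness of a set of positions. -/
def ConnectedDom (D : Set Pos) : Prop :=
  ∀ p ∈ D, ∀ q ∈ D, ∃ (n : ℕ) (c : ℕ → Pos), c 0 = p ∧ c n = q ∧
    (∀ k ≤ n, c k ∈ D) ∧ ∀ k < n, c (k + 1) - c k ∈ Nvn

/-- The connected linear neighborhood `N_n`. -/
def Nlin (n : ℤ) : Set Pos := {w | w.2 = 0 ∧ 0 < |w.1| ∧ |w.1| ≤ n}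

/-- The rectangular neighborhood `N_{m,n}`. -/
def Nrect (m n : ℤ) : Set Pos := {w | |w.1| ≤ m ∧ |w.2| ≤ n ∧ w ≠ (0, 0)}

/-- A set of consecutive integers. -/
def IsInterval (I : Set ℤ) : Prop :=
  ∀ a b c : ℤ, a ∈ I → c ∈ I → a ≤ b → b ≤ c → b ∈ I

/-- A path: a map from a set of consecutive integers to the plane, consecutive
positions being (von Neumann) adjacent. -/
def IsPath (I : Set ℤ) (P : ℤ → Pos) : Prop :=
  IsInterval I ∧ ∀ i : ℤ, i ∈ I → i + 1 ∈ I → P (i + 1) - P i ∈ Nvn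

/-- A T-tiled path: a path together with a map from its range to tiles of `T`. -/
def IsTiledPath {X : Type} {N : Set Pos} (T : Set (Tile X N)) (I : Set ℤ)
    (P : ℤ → Pos) (r : Pos → Option (Tile X N)) : Prop :=
  IsPath I P ∧ tdom r = P '' I ∧ ∀ p t, r p = some t → t ∈ T

/-- A T-ribbon: an injective tiled path in which consecutive tiles stick. -/
def IsRibbon {X : Type} (T : Set (Tile X Nvn)) (I : Set ℤ) (P : ℤ → Pos)
    (r : Pos → Option (Tile X Nvn)) : Prop :=
  IsTiledPath T I P r ∧ (∀ i ∈ I, ∀ j ∈ I, P i = P j → i = j) ∧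
  (∀ i : ℤ, i ∈ I → i + 1 ∈ I → ∀ t t', r (P i) = some t → r (P (i + 1)) = some t' →
    ∀ (hv : P (i + 1) - P i ∈ Nvn) (hv' : -(P (i + 1) - P i) ∈ Nvn),
      t ⟨P (i + 1) - P i, hv⟩ = t' ⟨-(P (i + 1) - P i), hv'⟩)

/-- A (T,N)-zipper: an injective tiled path whose tile map is a (T,N)-tiling. -/
def IsZipper {X : Type} {N : Set Pos} (T : Set (Tile X N)) (I : Set ℤ)
    (P : ℤ → Pos) (r : Pos → Option (Tile X N)) : Prop :=
  IsTiledPath T I P r ∧ (∀ i ∈ I, ∀ j ∈ I, P i = P j → i = j) ∧ IsTiling T r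

/-- Bundled T-ribbons (tile system in the von Neumann neighborhood). -/
structure Ribbon (X : Type) (T : Set (Tile X Nvn)) : Type where
  I : Set ℤ
  P : ℤ → Pos
  r : Pos → Option (Tile X Nvn)
  isRibbon : IsRibbon T I P r

/-- A poly-ribbon of scale `s` with macro path `(J, Q)` and components `ρ`. -/
def IsPolyRibbon {X : Type} {T : Set (Tile X Nvn)} (s : ℤ) (J : Set ℤ)
    (Q : ℤ → Pos) (ρ : Pos → Option (Ribbon X T)) : Prop :=
  IsPath J Q ∧ (∀ i ∈ J, ∀ j ∈ J, Q i = Q j → i = j) ∧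
  tdom ρ = Q '' J ∧
  (∀ u R, ρ u = some R → R.I.Finite ∧ R.I.Nonempty) ∧
  (∀ u v R S, u ≠ v → ρ u = some R → ρ v = some S →
    ∀ p, R.r p ≠ none → ∀ q, S.r q ≠ none → sc s u + p ≠ sc s v + q) ∧
  (∀ j : ℤ, j ∈ J → j + 1 ∈ J → ∀ R₁ R₂, ρ (Q j) = some R₁ → ρ (Q (j + 1)) = some R₂ →
    ∀ m₁, IsGreatest R₁.I m₁ → ∀ m₂, IsLeast R₂.I m₂ →
      ((sc s (Q (j + 1)) + R₂.P m₂) - (sc s (Q j) + R₁.P m₁) ∈ Nvn ∧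
      ∀ t₁ t₂, R₁.r (R₁.P m₁) = some t₁ → R₂.r (R₂.P m₂) = some t₂ →
        ∀ (hv : (sc s (Q (j + 1)) + R₂.P m₂) - (sc s (Q j) + R₁.P m₁) ∈ Nvn)
          (hv' : -((sc s (Q (j + 1)) + R₂.P m₂) - (sc s (Q j) + R₁.P m₁)) ∈ Nvn),
          t₁ ⟨(sc s (Q (j + 1)) + R₂.P m₂) - (sc s (Q j) + R₁.P m₁), hv⟩ =
            t₂ ⟨-((sc s (Q (j + 1)) + R₂.P m₂) - (sc s (Q j) + R₁.P m₁)), hv'⟩))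

/-- A zipper-simulation of `T` (in neighborhood `N`) by `Tμ` (in the von Neumann
neighborhood), of scale `s`, consisting of a polyomino assignment `phi`, the
trimming map `chi` and the simulation map `psi`. -/
structure ZipperSimulation (X Xμ : Type) (N : Set Pos) (T : Set (Tile X N))
    (Tμ : Set (Tile Xμ Nvn)) (s : ℤ) : Type where
  hs : 1 ≤ s
  phi : Tile X N → Set (Ribbon Xμ Tμ)
  phi_fin : ∀ t, ∀ R ∈ phi t, R.I.Finite ∧ R.I.Nonempty
  phi_ref : ∀ t, ∀ R ∈ phi t, R.r (0, 0) ≠ none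
  phi_spec : ∀ t t', t ≠ t' → ∀ R ∈ phi t, ∀ S ∈ phi t',
    ∀ p q a b, R.r p = some a → S.r q = some b → a ≠ b
  chi : Ribbon Xμ Tμ → Pos → Option (Ribbon Xμ Tμ)
  chi_poly : ∀ R : Ribbon Xμ Tμ, ∃ J Q, IsPolyRibbon s J Q (chi R)
  chi_sub : ∀ R u S, chi R u = some S →
    (∃ t ∈ T, S ∈ phi t) ∧ ∀ p a, S.r p = some a → R.r (sc s u + p) = some a
  chi_max : ∀ (R : Ribbon Xμ Tμ) (t : Tile X N), t ∈ T → ∀ S ∈ phi t, ∀ u : Pos,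
    (∀ p a, S.r p = some a → R.r (sc s u + p) = some a) → chi R u ≠ none
  psi : Set ℤ → (ℤ → Pos) → (Pos → Option (Tile X N)) → Set (Pos → Option (Ribbon Xμ Tμ))
  psi_nonempty : ∀ I P r, IsZipper T I P r → (psi I P r).Nonempty
  psi_poly : ∀ I P r, IsZipper T I P r → ∀ ρ ∈ psi I P r, IsPolyRibbon s I P ρ
  psi_comp : ∀ I P r, IsZipper T I P r → ∀ ρ ∈ psi I P r,
    ∀ u t, r u = some t → ∀ S, ρ u = some S → S ∈ phi t
  psi_exists : ∀ R : Ribbon Xμ Tμ, ∃ I P r, IsZipper T I P r ∧ chi R ∈ psi I P r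
  psi_unique : ∀ (R : Ribbon Xμ Tμ) I P r I' P' r',
    IsZipper T I P r → IsZipper T I' P' r' →
    chi R ∈ psi I P r → chi R ∈ psi I' P' r' →
    r = r' ∧ ∃ d : ℤ, (∀ i, i ∈ I ↔ i + d ∈ I') ∧ ∀ i ∈ I, P' (i + d) = P i

/-- A tiling-simulation of `T` (in neighborhood `N`) by `Tμ` (in the von Neumann
neighborhood), of scale `s`, consisting of a polyomino assignment `phi`, the
trimming map `chi` and the simulation map `psi`. -/
structure TilingSimulation (X Xμ : Type) (N : Set Pos) (T : Set (Tile X N))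
    (Tμ : Set (Tile Xμ Nvn)) (s : ℤ) : Type where
  hs : 1 ≤ s
  phi : Tile X N → Set (Pos → Option (Tile Xμ Nvn))
  phi_fin : ∀ t, ∀ τ' ∈ phi t, IsFiniteTiling Tμ τ'
  phi_ref : ∀ t, ∀ τ' ∈ phi t, τ' (0, 0) ≠ none
  phi_spec : ∀ t t', t ≠ t' → ∀ τ₁ ∈ phi t, ∀ τ₂ ∈ phi t',
    ∀ p q a b, τ₁ p = some a → τ₂ q = some b → a ≠ b
  chi : (Pos → Option (Tile Xμ Nvn)) → Pos → Option (Pos → Option (Tile Xμ Nvn))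
  chi_poly : ∀ τ', IsTiling Tμ τ' → IsPolyTiling Tμ s (chi τ')
  chi_sub : ∀ τ' u σu, chi τ' u = some σu →
    (∃ t ∈ T, σu ∈ phi t) ∧ ∀ p a, σu p = some a → τ' (sc s u + p) = some a
  chi_max : ∀ (τ' : Pos → Option (Tile Xμ Nvn)) (t : Tile X N), t ∈ T →
    ∀ σu ∈ phi t, ∀ u : Pos,
    (∀ p a, σu p = some a → τ' (sc s u + p) = some a) → chi τ' u ≠ none
  psi : (Pos → Option (Tile X N)) → Set (Pos → Option (Pos → Option (Tile Xμ Nvn)))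
  psi_nonempty : ∀ τ, IsTiling T τ → (psi τ).Nonempty
  psi_poly : ∀ τ, IsTiling T τ → ∀ σ ∈ psi τ, IsPolyTiling Tμ s σ
  psi_dom : ∀ τ, IsTiling T τ → ∀ σ ∈ psi τ, ∀ u, σ u ≠ none ↔ τ u ≠ none
  psi_comp : ∀ τ, IsTiling T τ → ∀ σ ∈ psi τ,
    ∀ u t, τ u = some t → ∀ σu, σ u = some σu → σu ∈ phi t
  psi_recover : ∀ τ', IsTiling Tμ τ' → ∃! τ, IsTiling T τ ∧ chi τ' ∈ psi τ

/-- Horizontal displacement, in macro cells, of the `r`-th row of a polyomino. Rows `2k` and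
`2k + 1` are displaced by `k` with respect to each other. -/
def rowShift (r : ℤ) : ℤ := if r % 2 = 0 then 0 else r / 2

/-- The macro position whose polyomino contains the cell `q`. -/
def owner (s : ℤ) (q : Pos) : Pos := (q.1 / s - rowShift (q.2 % s), q.2 / s)

/-- The last row of each macro line is left empty. -/
def Used (s : ℤ) (q : Pos) : Prop := q.2 % s ≠ s - 1

/-- Glues of the simulating system: the neutral glue, the glues of `X`, and one glue per tile,
which holds the cells of a polyomino together. -/
abbrev MicroGlue (X : Type) (N : Set Pos) : Type := Option (X ⊕ Tile X N)

/-- The glue of `t` in the horizontal direction `d`, neutral when `(d, 0) ∉ N`. -/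
noncomputable def checkGlue {X : Type} {N : Set Pos} (t : Tile X N) (d : ℤ) : MicroGlue X N :=
  if h : (d, 0) ∈ N then some (Sum.inl (t ⟨(d, 0), h⟩)) else none

/-- The tile placed at the cell `q` of a polyomino representing `t`. -/
noncomputable def microTile {X : Type} {N : Set Pos} (s : ℤ) (t : Tile X N) (q : Pos) :
    Tile (MicroGlue X N) Nvn := fun w =>
  if w.1.2 = 0 then
    if 0 ≤ q.1 % s + w.1.1 ∧ q.1 % s + w.1.1 < s then some (Sum.inr t) else none
  else checkGlue t (rowShift (q.2 % s) - rowShift (q.2 % s + w.1.2))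

/-- The tiling in the von Neumann neighborhood representing `τ`. -/
noncomputable def expand {X : Type} {N : Set Pos} (s : ℤ) (τ : Pos → Option (Tile X N)) :
    Pos → Option (Tile (MicroGlue X N) Nvn) := fun q =>
  if Used s q then (τ (owner s q)).map (fun t => microTile s t q) else none

/-- The polyomino representing the tile `t`. -/
noncomputable def polyomino {X : Type} {N : Set Pos} (s : ℤ) (t : Tile X N) :
    Pos → Option (Tile (MicroGlue X N) Nvn) :=
  expand s (fun u => if u = 0 then some t else none)

/-- The tile of `T` whose polyomino occurs in `τ'` at the macro position `u`, if any. -/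
noncomputable def decode {X : Type} {N : Set Pos} (T : Set (Tile X N)) (s : ℤ)
    (τ' : Pos → Option (Tile (MicroGlue X N) Nvn)) : Pos → Option (Tile X N) := fun u =>
  if h : ∃ t ∈ T, ∀ p a, polyomino s t p = some a → τ' (sc s u + p) = some a
    then some h.choose else none

section

variable {X : Type} {N : Set Pos} {T : Set (Tile X N)} {s : ℤ}

theorem owner_sc_add (hs : 0 < s) (u p : Pos) : owner s (sc s u + p) = u + owner s p := by
  ext <;> simp [owner, sc, Int.add_ediv_of_dvd_left, hs.ne', add_sub_assoc]

theorem used_sc_add (u p : Pos) : Used s (sc s u + p) ↔ Used s p := by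
  simp [Used, sc]

theorem microTile_sc_add (t : Tile X N) (u p : Pos) :
    microTile s t (sc s u + p) = microTile s t p := by
  funext w
  simp [microTile, sc]

theorem expand_eq_some {τ : Pos → Option (Tile X N)} {q : Pos} {a} :
    expand s τ q = some a ↔ Used s q ∧ ∃ t, τ (owner s q) = some t ∧ microTile s t q = a := by
  unfold expand
  split_ifs with h <;> simp [h]

theorem polyomino_eq_some {t : Tile X N} {q : Pos} {a} :
    polyomino s t q = some a ↔ Used s q ∧ owner s q = 0 ∧ microTile s t q = a := by
  unfold polyomino
  rw [expand_eq_some]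
  simp

theorem microTile_injective (hs : 2 ≤ s) {t t' : Tile X N} {p q : Pos}
    (h : microTile s t p = microTile s t' q) : t = t' := by
  have h0 := Int.emod_nonneg p.1 (by omega : s ≠ 0)
  have h1 := Int.emod_lt_of_pos p.1 (by omega : 0 < s)
  have key : ∀ w : {w : Pos // w ∈ Nvn}, w.1.2 = 0 → 0 ≤ p.1 % s + w.1.1 →
      p.1 % s + w.1.1 < s → t = t' := by
    intro w hw2 hw hw'
    have hw1 := congrFun h w
    simp only [microTile, hw2, hw, hw', and_self, if_true] at hw1
    split_ifs at hw1
    simpa using hw1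
  by_cases hp : p.1 % s + 1 < s
  · exact key ⟨(1, 0), by simp [Nvn]⟩ rfl (by simp; omega) hp
  · exact key ⟨(-1, 0), by simp [Nvn]⟩ rfl (by simp; omega) (by simp; omega)

theorem used_origin (hs : 2 ≤ s) : Used s 0 := by
  simp [Used]; omega

theorem owner_origin : owner s 0 = 0 := by
  simp [owner, rowShift]

theorem polyomino_origin (hs : 2 ≤ s) (t : Tile X N) :
    polyomino s t 0 = some (microTile s t 0) :=
  polyomino_eq_some.2 ⟨used_origin hs, owner_origin, rfl⟩

theorem polyomino_injective (hs : 2 ≤ s) :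
    Function.Injective (polyomino (X := X) (N := N) s) := by
  intro t t' h
  have := congrFun h 0
  rw [polyomino_origin hs, polyomino_origin hs] at this
  exact microTile_injective hs (Option.some.inj this)

theorem polyomino_disjoint (hs : 0 < s) {t t' : Tile X N} {u v p q : Pos} (huv : u ≠ v)
    (hp : polyomino s t p ≠ none) (hq : polyomino s t' q ≠ none) :
    sc s u + p ≠ sc s v + q := by
  obtain ⟨a, ha⟩ := Option.ne_none_iff_exists'.1 hp
  obtain ⟨b, hb⟩ := Option.ne_none_iff_exists'.1 hq
  intro h
  apply huv
  have h' := congrArg (owner s) h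
  rw [owner_sc_add hs, owner_sc_add hs, (polyomino_eq_some.1 ha).2.1,
    (polyomino_eq_some.1 hb).2.1] at h'
  simpa using h'

theorem expand_of_polyomino (hs : 0 < s) {τ : Pos → Option (Tile X N)} {u p : Pos}
    {t : Tile X N} {a} (hu : τ u = some t) (hp : polyomino s t p = some a) :
    expand s τ (sc s u + p) = some a := by
  obtain ⟨h1, h2, h3⟩ := polyomino_eq_some.1 hp
  exact expand_eq_some.2 ⟨(used_sc_add u p).2 h1, t, by simpa [owner_sc_add hs, h2] using hu,
    by rw [microTile_sc_add, h3]⟩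

theorem mem_Nvn {w : Pos} : w ∈ Nvn ↔
    (w.1 = 0 ∧ w.2 = 1) ∨ (w.1 = 1 ∧ w.2 = 0) ∨ (w.1 = 0 ∧ w.2 = -1) ∨
      (w.1 = -1 ∧ w.2 = 0) := by
  simp [Nvn, Prod.ext_iff]

theorem emod_ediv_unit_step (hs : 0 < s) (x : ℤ) {e : ℤ} (he : e = 1 ∨ e = -1) :
    (0 ≤ x % s + e ∧ x % s + e < s ∧ (x + e) % s = x % s + e ∧ (x + e) / s = x / s) ∨
      (¬ (0 ≤ x % s + e ∧ x % s + e < s) ∧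
        ¬ (0 ≤ (x + e) % s - e ∧ (x + e) % s - e < s)) := by
  have h0 := Int.emod_nonneg x hs.ne'
  have h1 := Int.emod_lt_of_pos x hs
  have hx := Int.emod_add_mul_ediv x s
  by_cases h : 0 ≤ x % s + e ∧ x % s + e < s
  · left
    have h2 : (x + e) % s = x % s + e := by
      rw [← Int.emod_add_emod, Int.emod_eq_of_lt h.1 h.2]
    refine ⟨h.1, h.2, h2, ?_⟩
    have hx' := Int.emod_add_mul_ediv (x + e) s
    exact mul_left_cancel₀ hs.ne' (by linarith)
  · right
    refine ⟨h, ?_⟩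
    rw [← Int.emod_add_emod]
    rcases he with rfl | rfl
    · have : x % s + 1 = s := by omega
      rw [this]; simp
    · have : x % s + -1 = -1 := by omega
      rw [this, ← Int.add_emod_right, Int.emod_eq_of_lt (by omega) (by omega)]
      omega

theorem isTiling_expand (hN : IsNeighborhood N) (hs : 0 < s) {τ : Pos → Option (Tile X N)}
    (hτ : IsTiling T τ) : IsTiling Set.univ (expand s τ) := by
  refine ⟨fun _ _ _ => trivial, fun q a ha w b hb hw hw' => ?_⟩
  obtain ⟨huq, t, ht, rfl⟩ := expand_eq_some.1 ha
  obtain ⟨huq', t', ht', rfl⟩ := expand_eq_some.1 hb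
  have hcase : (w.1 = 0 ∧ (w.2 = 1 ∨ w.2 = -1)) ∨ ((w.1 = 1 ∨ w.1 = -1) ∧ w.2 = 0) := by
    rcases mem_Nvn.1 hw with h | h | h | h <;> omega
  obtain ⟨x, y⟩ := q
  obtain ⟨i, e⟩ := w
  simp only [Used, Prod.mk_add_mk] at *
  rcases hcase with ⟨rfl, he⟩ | ⟨hi, rfl⟩
  · have he0 : e ≠ 0 := by omega
    simp only [microTile, Prod.neg_mk, he0, neg_eq_zero, if_false]
    rcases emod_ediv_unit_step hs y he with ⟨h1, h2, h3, h4⟩ | ⟨h1, -⟩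
    · rw [h3, add_neg_cancel_right]
      set d := rowShift (y % s) - rowShift (y % s + e) with hd
      have hd' : rowShift (y % s + e) - rowShift (y % s) = -d := by omega
      rw [hd']
      have hown : owner s (x + 0, y + e) = owner s (x, y) + (d, 0) := by
        ext <;> simp [owner, h3, h4, hd]
      rw [hown] at ht'
      by_cases hdN : (d, 0) ∈ N
      · have hdN' : (-d, 0) ∈ N := by simpa using hN.2.2 _ hdN
        have := hτ.2 _ _ ht (d, 0) t' ht' hdN (by simpa using hdN')
        simp only [checkGlue, hdN, hdN', dif_pos, this]
        simp
      · have hdN' : (-d, 0) ∉ N := fun h => hdN (by simpa using hN.2.2 _ h)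
        simp [checkGlue, hdN, hdN']
    · exfalso
      have h0 := Int.emod_nonneg y hs.ne'
      have h1 := Int.emod_lt_of_pos y hs
      rcases he with rfl | rfl
      · omega
      · have h2 : y % s + -1 = -1 := by omega
        apply huq'
        rw [← Int.emod_add_emod, h2, ← Int.add_emod_right,
          Int.emod_eq_of_lt (by omega) (by omega)]
        omega
  · simp only [microTile, Prod.neg_mk, neg_zero, if_true]
    rcases emod_ediv_unit_step hs x hi with ⟨h1, h2, h3, h4⟩ | ⟨h1, h2⟩
    · have hown : owner s (x + i, y + 0) = owner s (x, y) := by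
        simp [owner, h4]
      rw [hown, ht] at ht'
      obtain rfl := Option.some.inj ht'
      have h5 := Int.emod_nonneg x hs.ne'
      have h6 := Int.emod_lt_of_pos x hs
      simp [h1, h2, h3, h5, h6]
    · rw [if_neg h1, if_neg (by simpa [sub_eq_add_neg] using h2)]

theorem isTiling_polyomino (hN : IsNeighborhood N) (hs : 0 < s) (t : Tile X N) :
    IsTiling Set.univ (polyomino s t) := by
  refine isTiling_expand (T := Set.univ) hN hs ⟨fun _ _ _ => trivial, ?_⟩
  intro p t₁ h₁ w t₂ h₂ hw
  dsimp only at h₁ h₂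
  split_ifs at h₁ h₂ with hp hpw
  subst hp
  rw [zero_add] at hpw
  subst hpw
  exact absurd hw hN.2.1

theorem finite_tdom_polyomino (hs : 0 < s) (t : Tile X N) : (tdom (polyomino s t)).Finite := by
  have hfin : ((fun r => rowShift r) '' Set.Icc 0 s).Finite := (Set.finite_Icc 0 s).image _
  obtain ⟨B, hB⟩ := hfin.bddAbove
  obtain ⟨C, hC⟩ := hfin.bddBelow
  refine ((Set.finite_Icc (s * C) (s * B + s)).prod (Set.finite_Icc 0 s)).subset ?_
  rintro ⟨x, y⟩ hp
  obtain ⟨a, ha⟩ := Option.ne_none_iff_exists'.1 hp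
  have hown := (polyomino_eq_some.1 ha).2.1
  simp only [owner, Prod.ext_iff, Prod.fst_zero, Prod.snd_zero] at hown
  have h0 := Int.emod_nonneg y hs.ne'
  have h1 := Int.emod_lt_of_pos y hs
  have h2 := Int.emod_nonneg x hs.ne'
  have h3 := Int.emod_lt_of_pos x hs
  have hx := Int.emod_add_mul_ediv x s
  have hy := Int.emod_add_mul_ediv y s
  rw [hown.2] at hy
  have hb := hB (Set.mem_image_of_mem _ (⟨h0, h1.le⟩ : y % s ∈ Set.Icc 0 s))
  have hc := hC (Set.mem_image_of_mem _ (⟨h0, h1.le⟩ : y % s ∈ Set.Icc 0 s))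
  have hxs : x / s = rowShift (y % s) := by omega
  have hb' := mul_le_mul_of_nonneg_left hb hs.le
  have hc' := mul_le_mul_of_nonneg_left hc hs.le
  rw [hxs] at hx
  refine ⟨⟨?_, ?_⟩, ?_, ?_⟩ <;> simp only <;> linarith

/-- Polyominoes placed according to a partial map form a poly-tiling as soon as they all agree
with a common tiling. -/
theorem isPolyTiling_map_polyomino (hN : IsNeighborhood N) (hs : 0 < s)
    {τ : Pos → Option (Tile X N)} {G : Pos → Option (Tile (MicroGlue X N) Nvn)}
    (hG : IsTiling Set.univ G)
    (hτG : ∀ u t, τ u = some t → ∀ p a, polyomino s t p = some a → G (sc s u + p) = some a) :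
    IsPolyTiling Set.univ s (fun u => (τ u).map (polyomino s)) := by
  refine ⟨?_, ?_, ?_⟩
  · intro u τu hu
    obtain ⟨t, -, rfl⟩ := Option.map_eq_some_iff.1 hu
    exact ⟨isTiling_polyomino hN hs t, finite_tdom_polyomino hs t⟩
  · intro u v τu τv huv hu hv p hp q hq
    obtain ⟨t, -, rfl⟩ := Option.map_eq_some_iff.1 hu
    obtain ⟨t', -, rfl⟩ := Option.map_eq_some_iff.1 hv
    exact polyomino_disjoint hs huv hp hq
  · intro u u' τu τu' hu hu' v a ha v' b hb hw hw'
    obtain ⟨t, ht, rfl⟩ := Option.map_eq_some_iff.1 hu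
    obtain ⟨t', ht', rfl⟩ := Option.map_eq_some_iff.1 hu'
    exact hG.2 _ _ (hτG u t ht v a ha) _ b
      (by rw [add_sub_cancel]; exact hτG u' t' ht' v' b hb) hw hw'

theorem decode_spec {τ' : Pos → Option (Tile (MicroGlue X N) Nvn)} {u : Pos} {t : Tile X N}
    (h : decode T s τ' u = some t) :
    t ∈ T ∧ ∀ p a, polyomino s t p = some a → τ' (sc s u + p) = some a := by
  unfold decode at h
  split_ifs at h with hex
  obtain rfl := Option.some.inj h
  exact hex.choose_spec

theorem exists_rowShift_sub_eq {n k : ℤ} (hk : k ≠ 0) (hkn : |k| ≤ n) :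
    ∃ r e : ℤ, (e = 1 ∨ e = -1) ∧ 0 ≤ r ∧ r < 2 * n + 3 ∧ 0 ≤ r + e ∧ r + e < 2 * n + 3 ∧
      rowShift r - rowShift (r + e) = k := by
  rw [abs_le] at hkn
  rcases lt_or_gt_of_ne hk with h | h
  · refine ⟨-2 * k, 1, Or.inl rfl, by omega, by omega, by omega, by omega, ?_⟩
    unfold rowShift
    split_ifs <;> omega
  · refine ⟨2 * k + 1, -1, Or.inr rfl, by omega, by omega, by omega, by omega, ?_⟩
    unfold rowShift
    split_ifs <;> omega

theorem isTiling_decode (hN : IsNeighborhood N) (hlin : ∀ w ∈ N, w.2 = 0) {n : ℤ}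
    (hn0 : 0 ≤ n) (hn : ∀ w ∈ N, |w.1| ≤ n) (hs : s = 2 * n + 4)
    {τ' : Pos → Option (Tile (MicroGlue X N) Nvn)} (hτ' : IsTiling Set.univ τ') :
    IsTiling T (decode T s τ') := by
  refine ⟨fun p t h => (decode_spec h).1, ?_⟩
  intro u t ht w t' ht' hw hw'
  have hs0 : 0 < s := by omega
  obtain ⟨k, l⟩ := w
  obtain rfl : l = 0 := hlin _ hw
  have hk : k ≠ 0 := fun h => hN.2.1 (h ▸ hw)
  obtain ⟨r, e, he, h0, h1, h2, h3, hd⟩ := exists_rowShift_sub_eq hk (hn _ hw)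
  have he0 : e ≠ 0 := by omega
  have hr : r % s = r := Int.emod_eq_of_lt h0 (by omega)
  have hre : (r + e) % s = r + e := Int.emod_eq_of_lt h2 (by omega)
  have hp : polyomino s t (s * rowShift r, r) = some (microTile s t (s * rowShift r, r)) :=
    polyomino_eq_some.2 ⟨by simp only [Used, hr]; omega,
      by simp [owner, hr, hs0.ne', Int.ediv_eq_zero_of_lt h0 (by omega : r < s)], rfl⟩
  have hq : polyomino s t' (s * rowShift (r + e), r + e) =
      some (microTile s t' (s * rowShift (r + e), r + e)) :=
    polyomino_eq_some.2 ⟨by simp only [Used, hre]; omega,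
      by simp [owner, hre, hs0.ne', Int.ediv_eq_zero_of_lt h2 (by omega : r + e < s)], rfl⟩
  have hP := (decode_spec ht).2 _ _ hp
  have hQ := (decode_spec ht').2 _ _ hq
  have hpos : sc s (u + (k, 0)) + (s * rowShift (r + e), r + e) =
      sc s u + (s * rowShift r, r) + (0, e) := by
    ext
    · simp only [sc, Prod.fst_add, ← hd]; ring
    · simp only [sc, Prod.snd_add]; ring
  rw [hpos] at hQ
  have hmem : ((0, e) : Pos) ∈ Nvn := by
    rcases he with rfl | rfl <;> simp [Nvn]
  have hmem' : -((0, e) : Pos) ∈ Nvn := by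
    rcases he with rfl | rfl <;> simp [Nvn]
  have hglue := hτ'.2 _ _ hP _ _ hQ hmem hmem'
  have hd' : rowShift (r + e) - rowShift r = -k := by omega
  have hkN' : (-k, 0) ∈ N := by simpa using hw'
  simp only [microTile, Prod.neg_mk, he0, neg_eq_zero, if_false, hr, hre, hd,
    add_neg_cancel_right, hd', checkGlue, dif_pos hw, dif_pos hkN', Option.some.injEq,
    Sum.inl.injEq] at hglue
  simpa using hglue

theorem induced_map_polyomino_ne_none (hs : 0 < s) {τ : Pos → Option (Tile X N)} {q : Pos} :
    induced s (fun u => (τ u).map (polyomino s)) q ≠ none ↔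
      Used s q ∧ τ (owner s q) ≠ none := by
  constructor
  · intro h
    unfold induced at h
    split_ifs at h with hex
    · obtain ⟨a, u, τu, v, hu, hv, rfl⟩ := hex
      obtain ⟨t, ht, rfl⟩ := Option.map_eq_some_iff.1 hu
      obtain ⟨h1, t', h2, -⟩ := expand_eq_some.1 (expand_of_polyomino hs ht hv)
      exact ⟨h1, by simp [h2]⟩
    · exact absurd rfl h
  · rintro ⟨h1, h2⟩
    obtain ⟨t, ht⟩ := Option.ne_none_iff_exists'.1 h2
    unfold induced
    rw [dif_pos]
    · simp
    have hq : q = sc s (owner s q) + (q - sc s (owner s q)) := by abel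
    refine ⟨microTile s t (q - sc s (owner s q)), owner s q, polyomino s t,
      q - sc s (owner s q), by simp [ht], polyomino_eq_some.2 ⟨?_, ?_, rfl⟩, hq⟩
    · rwa [hq, used_sc_add] at h1
    · have := owner_sc_add hs (owner s q) (q - sc s (owner s q))
      rw [← hq] at this
      simpa using this

theorem lineConvex_induced_iff (hs : 2 ≤ s) {τ : Pos → Option (Tile X N)} :
    LineConvex (induced s (fun u => (τ u).map (polyomino s))) ↔ LineConvex τ := by
  have hs0 : 0 < s := by omega
  unfold LineConvex
  simp only [induced_map_polyomino_ne_none hs0]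
  constructor
  · intro h x₁ x₂ x y h₁ h₂ hlt₁ hlt₂
    have key : ∀ z : ℤ, Used s (s * z, s * y) ∧ owner s (s * z, s * y) = (z, y) := by
      intro z
      refine ⟨?_, by simp [owner, rowShift, hs0.ne']⟩
      simp only [Used, Int.mul_emod_right]
      omega
    have := h (s * x₁) (s * x₂) (s * x) (s * y) ⟨(key _).1, by rwa [(key _).2]⟩
      ⟨(key _).1, by rwa [(key _).2]⟩ (by gcongr) (by gcongr)
    rw [(key _).2] at this
    exact this.2
  · intro h x₁ x₂ x y h₁ h₂ hlt₁ hlt₂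
    refine ⟨h₁.1, ?_⟩
    have hle₁ : x₁ / s ≤ x / s := Int.ediv_le_ediv hs0 hlt₁.le
    have hle₂ : x / s ≤ x₂ / s := Int.ediv_le_ediv hs0 hlt₂.le
    have g₁ := h₁.2
    have g₂ := h₂.2
    simp only [owner] at g₁ g₂ ⊢
    rcases hle₁.eq_or_lt with heq | hlt
    · rwa [← heq]
    rcases hle₂.eq_or_lt with heq | hlt'
    · rwa [heq]
    exact h _ _ _ _ g₁ g₂ (by omega) (by omega)

/-- The simulation of a tile system in a linear neighborhood by polyominoes made of shifted
rows. -/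
noncomputable def linearSimulation (hN : IsNeighborhood N) (hlin : ∀ w ∈ N, w.2 = 0)
    {n : ℤ} (hn0 : 0 ≤ n) (hn : ∀ w ∈ N, |w.1| ≤ n) :
    TilingSimulation X (MicroGlue X N) N T Set.univ (2 * n + 4) where
  hs := by omega
  phi t := {polyomino (2 * n + 4) t}
  phi_fin := by
    rintro t _ rfl
    exact ⟨isTiling_polyomino hN (by omega) t, finite_tdom_polyomino (by omega) t⟩
  phi_ref := by
    rintro t _ rfl
    change polyomino (2 * n + 4) t 0 ≠ none
    simp [polyomino_origin (by omega : 2 ≤ 2 * n + 4) t]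
  phi_spec := by
    rintro t t' htt' _ rfl _ rfl p q a b ha hb rfl
    exact htt' (microTile_injective (by omega)
      ((polyomino_eq_some.1 ha).2.2.trans (polyomino_eq_some.1 hb).2.2.symm))
  chi τ' := fun u => (decode T (2 * n + 4) τ' u).map (polyomino (2 * n + 4))
  chi_poly τ' hτ' := isPolyTiling_map_polyomino hN (by omega) hτ'
    fun _ _ h => (decode_spec h).2
  chi_sub := by
    intro τ' u σu h
    obtain ⟨t, ht, rfl⟩ := Option.map_eq_some_iff.1 h
    exact ⟨⟨t, (decode_spec ht).1, rfl⟩, (decode_spec ht).2⟩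
  chi_max := by
    rintro τ' t ht _ rfl u h
    have hex : ∃ t ∈ T, ∀ p a, polyomino (2 * n + 4) t p = some a →
        τ' (sc (2 * n + 4) u + p) = some a := ⟨t, ht, h⟩
    rw [decode, dif_pos hex]
    simp
  psi τ := {fun u => (τ u).map (polyomino (2 * n + 4))}
  psi_nonempty _ _ := Set.singleton_nonempty _
  psi_poly := by
    rintro τ hτ _ rfl
    exact isPolyTiling_map_polyomino hN (by omega) (isTiling_expand hN (by omega) hτ)
      fun _ _ h _ _ => expand_of_polyomino (by omega) h
  psi_dom := by
    rintro τ - _ rfl u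
    simp
  psi_comp := by
    rintro τ - _ rfl u t ht _ h
    simp only [ht, Option.map_some, Option.some.injEq] at h
    exact h.symm
  psi_recover := by
    intro τ' hτ'
    refine ⟨decode T (2 * n + 4) τ', ⟨isTiling_decode hN hlin hn0 hn rfl hτ', rfl⟩, ?_⟩
    rintro τ ⟨-, h⟩
    funext u
    exact (Option.map_injective (polyomino_injective (by omega)) (congrFun h u)).symm

end

/-- for a linear neighborhood, a tiling-simulation preserving line
convexity. -/
theorem stmt13 (X : Type) [Fintype X] (N : Set Pos) (hN : IsNeighborhood N)
    (hlin : ∀ w ∈ N, w.2 = 0) (T : Set (Tile X N)) (hT : T.Finite) :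
    ∃ (Xμ : Type) (_ : Fintype Xμ) (Tμ : Set (Tile Xμ Nvn)) (_ : Tμ.Finite)
      (s : ℤ) (sim : TilingSimulation X Xμ N T Tμ s),
      ∀ τ, IsTiling T τ →
        (LineConvex τ ↔ ∀ σ ∈ sim.psi τ, LineConvex (induced s σ)) := by
  obtain ⟨n, hn⟩ := (hN.1.image fun w => |w.1|).bddAbove
  have hn' : ∀ w ∈ N, |w.1| ≤ max n 0 := fun w hw =>
    (hn (Set.mem_image_of_mem _ hw)).trans (le_max_left n 0)
  have hn0 : 0 ≤ max n 0 := le_max_right n 0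
  have : Finite {w : Pos // w ∈ N} := hN.1
  have : Finite {w : Pos // w ∈ Nvn} := by
    have : Nvn.Finite := by unfold Nvn; exact Set.toFinite _
    exact this
  refine ⟨MicroGlue X N, Fintype.ofFinite _, Set.univ, Set.toFinite _, 2 * max n 0 + 4,
    linearSimulation hN hlin hn0 hn', fun τ _ => ?_⟩
  simp only [linearSimulation, Set.mem_singleton_iff, forall_eq]
  exact (lineConvex_induced_iff (by omega)).symm

end Paper
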